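/- arXiv:1708.07964 — 2 statements merged into one kernel-verified Lean document; each statement's English description precedes it below -/
import Mathlib

section
/- Let k1, k2, m, M be positive integers, S1 an integer with 0 ≤ S1 ≤ m, S2 an integer with 0 ≤ S2 ≤ M, and set D = k1(m − S1) + k2(M − S2), C = −D − k2·S2, B = −D − k1·S1, A = D + k1·S1 + k2·S2. If D > 0 and S1 + S2 > 0, then the polynomial equation A·q^(k1+k2) + B·q^(k1) + C·q^(k2) + D = 0 has exactly one root q in the open interval (0,1). -/
/-- For `a, b ≥ 0` not both zero, `q ↦ a q^k/(1-q^k) + b q^l/(1-q^l)` is strictly increasing on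
`(0,1)`. -/
lemma strictMonoOn_odds_pow {k l : ℕ} (hk : 0 < k) (hl : 0 < l) {a b : ℝ} (ha : 0 ≤ a)
    (hb : 0 ≤ b) (hab : 0 < a + b) :
    StrictMonoOn (fun q : ℝ ↦ a * (q ^ k / (1 - q ^ k)) + b * (q ^ l / (1 - q ^ l)))
      (Set.Ioo 0 1) := by
  intro x hx y hy hxy
  have odds_lt {n : ℕ} (hn : 0 < n) : x ^ n / (1 - x ^ n) < y ^ n / (1 - y ^ n) := by
    have hx1 : x ^ n < 1 := pow_lt_one₀ hx.1.le hx.2 hn.ne'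
    have hy1 : y ^ n < 1 := pow_lt_one₀ hy.1.le hy.2 hn.ne'
    have hpow : x ^ n < y ^ n := pow_lt_pow_left₀ hxy hx.1.le hn.ne'
    rw [div_lt_div_iff₀ (by linarith) (by linarith)]
    linarith
  have h1 := odds_lt hk
  have h2 := odds_lt hl
  have h3 := mul_le_mul_of_nonneg_left h1.le ha
  have h4 := mul_le_mul_of_nonneg_left h2.le hb
  rcases ha.eq_or_lt with rfl | ha
  · have := mul_lt_mul_of_pos_left h2 (show 0 < b by linarith)
    dsimp only
    linarith
  · have := mul_lt_mul_of_pos_left h1 ha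
    dsimp only
    linarith

lemma exists_root_two_stage_score {k l : ℕ} (hk : 0 < k) (hl : 0 < l) {a b d : ℝ} (ha : 0 ≤ a)
    (hb : 0 ≤ b) (hab : 0 < a + b) (hd : 0 < d) :
    ∃ q ∈ Set.Ioo (0 : ℝ) 1,
      d * (1 - q ^ k) * (1 - q ^ l) = a * q ^ k * (1 - q ^ l) + b * q ^ l * (1 - q ^ k) := by
  -- The score divided by `1 - q` changes sign on `[0,1]`.
  let R : ℝ → ℝ := fun q ↦ (d * (1 - q ^ k) - a * q ^ k) * ∑ i ∈ Finset.range l, q ^ i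
    - b * q ^ l * ∑ i ∈ Finset.range k, q ^ i
  have hR : ContinuousOn R (Set.Icc 0 1) := by fun_prop
  have hR0 : 0 < R 0 := by
    simp [R, hk.ne', hl.ne', zero_pow_eq, hl, hd]
  have hR1 : R 1 < 0 := by
    have hk' : (1 : ℝ) ≤ k := by exact_mod_cast hk
    have hl' : (1 : ℝ) ≤ l := by exact_mod_cast hl
    simp only [R, one_pow, Finset.sum_const, Finset.card_range, nsmul_eq_mul, mul_one]
    nlinarith [mul_le_mul_of_nonneg_left hk' hb, mul_le_mul_of_nonneg_left hl' ha]
  obtain ⟨q, hq, hRq⟩ := intermediate_value_Ioo' zero_le_one hR ⟨hR1, hR0⟩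
  refine ⟨q, hq, ?_⟩
  simp only [R] at hRq
  linear_combination (1 - q) * hRq - (d * (1 - q ^ k) - a * q ^ k) * mul_neg_geom_sum q l
    + b * q ^ l * mul_neg_geom_sum q k

/-- Lemma 1: the two-stage group-testing score polynomial has exactly one root in (0,1). -/
theorem stmt_0 (k1 k2 m M : ℕ) (hk1 : 0 < k1) (hk2 : 0 < k2)
    (hm : 0 < m) (hM : 0 < M)
    (S1 S2 : ℕ) (hS1 : S1 ≤ m) (hS2 : S2 ≤ M)
    (D C B A : ℝ)
    (hD : D = k1 * ((m : ℝ) - S1) + k2 * ((M : ℝ) - S2))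
    (hC : C = -D - k2 * S2) (hB : B = -D - k1 * S1)
    (hA : A = D + k1 * S1 + k2 * S2)
    (hDpos : 0 < D) (hSpos : 0 < S1 + S2) :
    ∃! q : ℝ, q ∈ Set.Ioo (0 : ℝ) 1 ∧
      A * q ^ (k1 + k2) + B * q ^ k1 + C * q ^ k2 + D = 0 := by
  have ha : (0 : ℝ) ≤ k1 * S1 := by positivity
  have hb : (0 : ℝ) ≤ k2 * S2 := by positivity
  have hab : (0 : ℝ) < k1 * S1 + k2 * S2 := by
    have : 0 < k1 * S1 + k2 * S2 := by
      rcases Nat.eq_zero_or_pos S1 with rfl | h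
      · have : 0 < S2 := by omega
        positivity
      · positivity
    exact_mod_cast this
  have hroot (q : ℝ) : A * q ^ (k1 + k2) + B * q ^ k1 + C * q ^ k2 + D =
      D * (1 - q ^ k1) * (1 - q ^ k2) -
        (k1 * S1 * q ^ k1 * (1 - q ^ k2) + k2 * S2 * q ^ k2 * (1 - q ^ k1)) := by
    rw [hA, hB, hC]
    ring
  simp only [hroot, sub_eq_zero]
  obtain ⟨q, hq, hq0⟩ := exists_root_two_stage_score hk1 hk2 ha hb hab hDpos
  have odds_eq {x : ℝ} (hx : x ∈ Set.Ioo (0 : ℝ) 1)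
      (h : D * (1 - x ^ k1) * (1 - x ^ k2) =
        k1 * S1 * x ^ k1 * (1 - x ^ k2) + k2 * S2 * x ^ k2 * (1 - x ^ k1)) :
      (k1 * S1 : ℝ) * (x ^ k1 / (1 - x ^ k1)) + k2 * S2 * (x ^ k2 / (1 - x ^ k2)) = D := by
    have h1 : 1 - x ^ k1 ≠ 0 := (sub_pos.2 (pow_lt_one₀ hx.1.le hx.2 hk1.ne')).ne'
    have h2 : 1 - x ^ k2 ≠ 0 := (sub_pos.2 (pow_lt_one₀ hx.1.le hx.2 hk2.ne')).ne'
    field_simp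
    linear_combination -h
  refine ⟨q, ⟨hq, hq0⟩, fun y ⟨hy, hy0⟩ ↦ ?_⟩
  exact (strictMonoOn_odds_pow hk1 hk2 ha hb hab).injOn hy hq
    ((odds_eq hy hy0).trans (odds_eq hq hq0).symm)
end

section
/- Let k be a positive integer, p ∈ (0,1), q = 1 − p, θ = 1 − q^k, and g(x) = 1 − (1−x)^{1/k}. For each positive integer n define the exact expectation E_n = ∑_{j=0}^{n} C(n,j)·θ^j·(1−θ)^{n−j}·g(j/n). Then n·(E_n − p) → e_k(q) as n → ∞, where e_k(q) = ((k−1)/(2k²))·q·(q^{−k} − 1). -/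
open Filter Topology Asymptotics

/-- The expectation of `φ S`, where `S` is binomially distributed with parameters `n` and `θ`. -/
noncomputable def binomialMean (θ : ℝ) (n : ℕ) (φ : ℕ → ℝ) : ℝ :=
  ∑ j ∈ Finset.range (n + 1), (n.choose j : ℝ) * θ ^ j * (1 - θ) ^ (n - j) * φ j

namespace binomialMean

variable {θ : ℝ} {n : ℕ} {φ ψ : ℕ → ℝ}

theorem add : binomialMean θ n (fun j => φ j + ψ j) = binomialMean θ n φ + binomialMean θ n ψ := by
  simp only [binomialMean, mul_add, Finset.sum_add_distrib]

theorem const_mul (c : ℝ) : binomialMean θ n (fun j => c * φ j) = c * binomialMean θ n φ := by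
  simp only [binomialMean, Finset.mul_sum]
  exact Finset.sum_congr rfl fun j _ => by ring

theorem const (c : ℝ) : binomialMean θ n (fun _ => c) = c := by
  have h := add_pow θ (1 - θ) n
  rw [add_sub_cancel, one_pow] at h
  rw [binomialMean, ← Finset.sum_mul]
  convert one_mul c using 2
  refine Eq.trans (Finset.sum_congr rfl fun j _ => ?_) h.symm
  ring

theorem mono (hθ : θ ∈ Set.Icc (0 : ℝ) 1) (h : ∀ j ≤ n, φ j ≤ ψ j) :
    binomialMean θ n φ ≤ binomialMean θ n ψ := by
  refine Finset.sum_le_sum fun j hj => mul_le_mul_of_nonneg_left (h j ?_) ?_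
  · exact Nat.lt_succ_iff.mp (Finset.mem_range.mp hj)
  · have := hθ.1
    have := sub_nonneg.mpr hθ.2
    positivity

theorem abs_le_mean (hθ : θ ∈ Set.Icc (0 : ℝ) 1) (h : ∀ j ≤ n, |φ j| ≤ ψ j) :
    |binomialMean θ n φ| ≤ binomialMean θ n ψ := by
  refine abs_le.mpr ⟨?_, mono hθ fun j hj => (le_abs_self _).trans (h j hj)⟩
  have := mono (φ := fun j => -1 * ψ j) hθ fun j hj => by
    simpa using neg_le_of_abs_le (h j hj)
  rw [const_mul] at this
  linarith

theorem succ (θ : ℝ) (n : ℕ) (φ : ℕ → ℝ) :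
    binomialMean θ (n + 1) φ =
      θ * binomialMean θ n (fun j => φ (j + 1)) + (1 - θ) * binomialMean θ n φ := by
  have h := Finset.sum_choose_succ_mul (fun i j => θ ^ i * (1 - θ) ^ j * φ i) n
  simp only [← mul_assoc] at h
  rw [binomialMean, h, add_comm, binomialMean, binomialMean, Finset.mul_sum, Finset.mul_sum]
  congr 1
  · exact Finset.sum_congr rfl fun j _ => by ring
  · refine Finset.sum_congr rfl fun j hj => ?_
    rw [Nat.succ_sub (Nat.lt_succ_iff.mp (Finset.mem_range.mp hj)), pow_succ]
    ring

theorem centralMoment_succ (θ : ℝ) (n m : ℕ) :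
    binomialMean θ (n + 1) (fun j => ((j : ℝ) - (n + 1 : ℕ) * θ) ^ m) =
      θ * binomialMean θ n (fun j => (((j : ℝ) - n * θ) + (1 - θ)) ^ m) +
        (1 - θ) * binomialMean θ n (fun j => (((j : ℝ) - n * θ) - θ) ^ m) := by
  rw [succ]
  congr! 5 <;> · push_cast; ring

theorem centralMoments (θ : ℝ) (n : ℕ) :
    binomialMean θ n (fun j => (j : ℝ) - n * θ) = 0 ∧
    binomialMean θ n (fun j => ((j : ℝ) - n * θ) ^ 2) = n * (θ * (1 - θ)) ∧
    binomialMean θ n (fun j => ((j : ℝ) - n * θ) ^ 3) = n * (θ * (1 - θ)) * (1 - 2 * θ) ∧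
    binomialMean θ n (fun j => ((j : ℝ) - n * θ) ^ 4) =
      n * (θ * (1 - θ)) * (1 + 3 * (n - 2) * (θ * (1 - θ))) := by
  induction n with
  | zero => simp [binomialMean]
  | succ n ih =>
    obtain ⟨h₁, h₂, h₃, h₄⟩ := ih
    have e₁ (c : ℝ) : binomialMean θ n (fun j => ((j : ℝ) - n * θ) + c) = c := by
      rw [add, const, h₁, zero_add]
    have e₂ (c : ℝ) : binomialMean θ n (fun j => (((j : ℝ) - n * θ) + c) ^ 2) =
        n * (θ * (1 - θ)) + c ^ 2 := by
      have : (fun j : ℕ => (((j : ℝ) - n * θ) + c) ^ 2) = fun j : ℕ =>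
          ((j : ℝ) - n * θ) ^ 2 + (2 * c * ((j : ℝ) - n * θ) + c ^ 2) := by
        funext j; ring
      rw [this, add, add, const_mul, const, h₁, h₂]
      ring
    have e₃ (c : ℝ) : binomialMean θ n (fun j => (((j : ℝ) - n * θ) + c) ^ 3) =
        n * (θ * (1 - θ)) * (1 - 2 * θ) + 3 * c * (n * (θ * (1 - θ))) + c ^ 3 := by
      have : (fun j : ℕ => (((j : ℝ) - n * θ) + c) ^ 3) = fun j : ℕ =>
          ((j : ℝ) - n * θ) ^ 3 + (3 * c * ((j : ℝ) - n * θ) ^ 2 +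
            (3 * c ^ 2 * ((j : ℝ) - n * θ) + c ^ 3)) := by
        funext j; ring
      rw [this, add, add, add, const_mul, const_mul, const, h₁, h₂, h₃]
      ring
    have e₄ (c : ℝ) : binomialMean θ n (fun j => (((j : ℝ) - n * θ) + c) ^ 4) =
        n * (θ * (1 - θ)) * (1 + 3 * (n - 2) * (θ * (1 - θ))) +
          4 * c * (n * (θ * (1 - θ)) * (1 - 2 * θ)) + 6 * c ^ 2 * (n * (θ * (1 - θ))) + c ^ 4 := by
      have : (fun j : ℕ => (((j : ℝ) - n * θ) + c) ^ 4) = fun j : ℕ =>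
          ((j : ℝ) - n * θ) ^ 4 + (4 * c * ((j : ℝ) - n * θ) ^ 3 +
            (6 * c ^ 2 * ((j : ℝ) - n * θ) ^ 2 + (4 * c ^ 3 * ((j : ℝ) - n * θ) + c ^ 4))) := by
        funext j; ring
      rw [this, add, add, add, add, const_mul, const_mul, const_mul, const, h₁, h₂, h₃, h₄]
      ring
    have s₁ := centralMoment_succ θ n 1
    simp only [pow_one] at s₁
    refine ⟨?_, ?_, ?_, ?_⟩
    · rw [s₁]
      simp only [sub_eq_add_neg _ θ, e₁]
      ring
    all_goals
      rw [centralMoment_succ]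
      simp only [fun j : ℕ => sub_eq_add_neg ((j : ℝ) - n * θ) θ, e₂, e₃, e₄]
      push_cast
      ring

theorem div_sub_pow (hn : n ≠ 0) (m : ℕ) :
    binomialMean θ n (fun j => ((j : ℝ) / n - θ) ^ m) =
      (1 / (n : ℝ) ^ m) * binomialMean θ n (fun j => ((j : ℝ) - n * θ) ^ m) := by
  have : (n : ℝ) ≠ 0 := Nat.cast_ne_zero.mpr hn
  rw [← const_mul]
  congr 1
  funext j
  rw [div_mul_eq_mul_div, one_mul, ← div_pow]
  congr 1
  field_simp

theorem mul_div_sub_sq (hn : n ≠ 0) :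
    n * binomialMean θ n (fun j => ((j : ℝ) / n - θ) ^ 2) = θ * (1 - θ) := by
  have : (n : ℝ) ≠ 0 := Nat.cast_ne_zero.mpr hn
  rw [div_sub_pow hn, (centralMoments θ n).2.1]
  field_simp

theorem mul_div_sub_pow_four_le (hθ : θ ∈ Set.Icc (0 : ℝ) 1) (hn : n ≠ 0) :
    n * binomialMean θ n (fun j => ((j : ℝ) / n - θ) ^ 4) ≤ 1 / n := by
  have h1 : (1 : ℝ) ≤ n := by exact_mod_cast Nat.one_le_iff_ne_zero.mpr hn
  have h0 : (0 : ℝ) < n := by linarith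
  rw [div_sub_pow hn, (centralMoments θ n).2.2.2]
  set v := θ * (1 - θ)
  have hv0 : 0 ≤ v := mul_nonneg hθ.1 (sub_nonneg.mpr hθ.2)
  have hv1 : v ≤ 1 / 4 := by
    simp only [v]
    nlinarith [sq_nonneg (θ - 1 / 2)]
  have key : v * (1 + 3 * (n - 2) * v) ≤ n := by
    nlinarith [mul_nonneg hv0 hv0, mul_le_mul hv1 hv1 hv0 (by norm_num)]
  calc (n : ℝ) * (1 / (n : ℝ) ^ 4 * (n * v * (1 + 3 * (n - 2) * v)))
      = (v * (1 + 3 * (n - 2) * v)) / (n : ℝ) ^ 2 := by field_simp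
    _ ≤ n / (n : ℝ) ^ 2 := by gcongr
    _ = 1 / (n : ℝ) := by field_simp

end binomialMean

theorem exists_abs_le_mul_sq_add_mul_pow_four {R : ℝ → ℝ} {θ M ε : ℝ}
    (hM : ∀ x ∈ Set.Icc (0 : ℝ) 1, |R x| ≤ M)
    (hR : R =o[𝓝 θ] fun x => (x - θ) ^ 2) (hε : 0 < ε) :
    ∃ C, 0 ≤ C ∧ ∀ x ∈ Set.Icc (0 : ℝ) 1, |R x| ≤ ε * (x - θ) ^ 2 + C * (x - θ) ^ 4 := by
  obtain ⟨δ, hδ, h⟩ := Metric.eventually_nhds_iff.mp (hR.def hε)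
  have hM0 : 0 ≤ M := (abs_nonneg _).trans (hM 0 (by simp))
  refine ⟨M / δ ^ 4, by positivity, fun x hx => ?_⟩
  have h2 := even_two.pow_nonneg (x - θ)
  have h4 := (show Even 4 by decide).pow_nonneg (x - θ)
  rcases lt_or_ge (dist x θ) δ with hd | hd
  · have := h hd
    rw [Real.norm_eq_abs, Real.norm_eq_abs, abs_of_nonneg h2] at this
    have : 0 ≤ M / δ ^ 4 * (x - θ) ^ 4 := by positivity
    linarith
  · have hpow : δ ^ 4 ≤ (x - θ) ^ 4 := by
      rw [← (show Even 4 by decide).pow_abs (x - θ)]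
      rw [Real.dist_eq] at hd
      gcongr
    have : M ≤ M / δ ^ 4 * (x - θ) ^ 4 := by
      rw [div_mul_eq_mul_div, le_div_iff₀ (by positivity)]
      gcongr
    have := hM x hx
    have : 0 ≤ ε * (x - θ) ^ 2 := by positivity
    linarith

/-- **Voronovskaya's theorem** at a point, for a bounded function with a second order
expansion there. -/
theorem tendsto_mul_binomialMean_sub {f : ℝ → ℝ} {θ a b M : ℝ} (hθ : θ ∈ Set.Icc (0 : ℝ) 1)
    (hM : ∀ x ∈ Set.Icc (0 : ℝ) 1, |f x| ≤ M)
    (hf : (fun x => f x - f θ - a * (x - θ) - b * (x - θ) ^ 2) =o[𝓝 θ] fun x => (x - θ) ^ 2) :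
    Tendsto (fun n : ℕ => n * (binomialMean θ n (fun j => f ((j : ℝ) / n)) - f θ)) atTop
      (𝓝 (b * (θ * (1 - θ)))) := by
  set R : ℝ → ℝ := fun x => f x - f θ - a * (x - θ) - b * (x - θ) ^ 2
  have hRM : ∀ x ∈ Set.Icc (0 : ℝ) 1, |R x| ≤ M + M + |a| + |b| := by
    intro x hx
    have hd : |x - θ| ≤ 1 := abs_le.mpr ⟨by linarith [hx.1, hθ.2], by linarith [hx.2, hθ.1]⟩
    have ha : |a * (x - θ)| ≤ |a| := by
      rw [abs_mul]
      exact mul_le_of_le_one_right (abs_nonneg _) hd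
    have hb : |b * (x - θ) ^ 2| ≤ |b| := by
      rw [abs_mul, abs_pow]
      exact mul_le_of_le_one_right (abs_nonneg _) (pow_le_one₀ (abs_nonneg _) hd)
    linarith [abs_sub (f x - f θ - a * (x - θ)) (b * (x - θ) ^ 2),
      abs_sub (f x - f θ) (a * (x - θ)), abs_sub (f x) (f θ), hM x hx, hM θ hθ]
  have hsplit : ∀ n : ℕ, n ≠ 0 →
      n * (binomialMean θ n (fun j => f ((j : ℝ) / n)) - f θ) - b * (θ * (1 - θ)) =
        n * binomialMean θ n (fun j => R ((j : ℝ) / n)) := by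
    intro n hn
    have hfR : (fun j : ℕ => f ((j : ℝ) / n)) = fun j : ℕ => R ((j : ℝ) / n) +
        (f θ + (a * ((j : ℝ) / n - θ) ^ 1 + b * ((j : ℝ) / n - θ) ^ 2)) := by
      funext j
      simp only [R]
      ring
    have h1 : binomialMean θ n (fun j => ((j : ℝ) / n - θ) ^ 1) = 0 := by
      rw [binomialMean.div_sub_pow hn]
      simp only [pow_one, (binomialMean.centralMoments θ n).1, mul_zero]
    rw [hfR, binomialMean.add, binomialMean.add, binomialMean.add, binomialMean.const_mul,
      binomialMean.const_mul, binomialMean.const, h1, ← binomialMean.mul_div_sub_sq hn]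
    ring
  rw [Metric.tendsto_atTop']
  intro ε hε
  obtain ⟨C, hC, hRC⟩ := exists_abs_le_mul_sq_add_mul_pow_four hRM hf hε
  obtain ⟨N, hN⟩ := exists_nat_gt (2 * C / ε)
  refine ⟨N, fun n hn => ?_⟩
  have hn0 : n ≠ 0 := by omega
  have hnpos : (0 : ℝ) < n := by positivity
  have hCn : C * (1 / n) < ε / 2 := by
    have : 2 * C / ε < n := hN.trans (by exact_mod_cast hn)
    rw [div_lt_iff₀ hε] at this
    rw [mul_one_div, div_lt_iff₀ hnpos]
    linarith
  have hv : θ * (1 - θ) ≤ 1 / 4 := by nlinarith [sq_nonneg (θ - 1 / 2)]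
  rw [Real.dist_eq, hsplit n hn0, abs_mul, abs_of_pos hnpos]
  calc (n : ℝ) * |binomialMean θ n (fun j => R ((j : ℝ) / n))|
      ≤ n * binomialMean θ n
          (fun j => ε * ((j : ℝ) / n - θ) ^ 2 + C * ((j : ℝ) / n - θ) ^ 4) := by
        refine mul_le_mul_of_nonneg_left (binomialMean.abs_le_mean hθ fun j hj => hRC _ ?_) hnpos.le
        exact ⟨by positivity, div_le_one_of_le₀ (by exact_mod_cast hj) hnpos.le⟩
    _ = ε * (n * binomialMean θ n (fun j => ((j : ℝ) / n - θ) ^ 2)) +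
          C * (n * binomialMean θ n (fun j => ((j : ℝ) / n - θ) ^ 4)) := by
        rw [binomialMean.add, binomialMean.const_mul, binomialMean.const_mul]
        ring
    _ ≤ ε * (1 / 4) + C * (1 / n) := by
        rw [binomialMean.mul_div_sub_sq hn0]
        gcongr
        exact binomialMean.mul_div_sub_pow_four_le hθ hn0
    _ < ε := by linarith

theorem isLittleO_second_order {f f' : ℝ → ℝ} {s : Set ℝ} {x₀ b : ℝ} (hs : Convex ℝ s)
    (hx₀ : s ∈ 𝓝 x₀) (hf : ∀ x ∈ s, HasDerivAt f (f' x) x) (hf' : HasDerivAt f' (2 * b) x₀) :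
    (fun x => f x - f x₀ - f' x₀ * (x - x₀) - b * (x - x₀) ^ 2) =o[𝓝 x₀]
      fun x => (x - x₀) ^ 2 := by
  have hR : ∀ x ∈ s, HasDerivWithinAt
      (fun x => f x - f x₀ - f' x₀ * (x - x₀) - b * (x - x₀) ^ 2)
      (f' x - f' x₀ - (x - x₀) * (2 * b)) s x := by
    intro x hx
    have hid := (hasDerivAt_id' x).sub_const x₀
    have := (((hf x hx).sub_const (f x₀)).sub (hid.const_mul (f' x₀))).sub
      ((hid.pow 2).const_mul b)
    refine (this.congr_deriv ?_).hasDerivWithinAt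
    norm_num
    ring
  have hlin : (fun x => f' x - f' x₀ - (x - x₀) * (2 * b)) =o[𝓝[s] x₀]
      fun x => (x - x₀) ^ 1 := by
    simpa using (hasDerivAt_iff_isLittleO.mp hf').mono nhdsWithin_le_nhds
  have := hs.isLittleO_pow_succ_real (mem_of_mem_nhds hx₀) hR hlin
  rw [nhdsWithin_eq_nhds.mpr hx₀] at this
  simpa using this


/-- The asymptotic bias expansion of the group-testing MLE: n·(E(p̂_{n,k}) - p) → e_k(q),
where e_k(q) = ((k-1)/(2k²))·q·(q^(-k) - 1). -/
theorem stmt_11 (k : ℕ) (hk : 0 < k) (p : ℝ) (hp : p ∈ Set.Ioo (0 : ℝ) 1)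
    (q θ : ℝ) (hq : q = 1 - p) (hθ : θ = 1 - q ^ k)
    (g : ℝ → ℝ) (hg : g = fun x => 1 - (1 - x) ^ ((1 : ℝ) / k))
    (E : ℕ → ℝ)
    (hE : ∀ n, E n = ∑ j ∈ Finset.range (n + 1),
      (n.choose j : ℝ) * θ ^ j * (1 - θ) ^ (n - j) * g ((j : ℝ) / n))
    (e : ℝ) (he : e = ((k : ℝ) - 1) / (2 * k ^ 2) * q * (q ^ (-(k : ℝ)) - 1)) :
    Filter.Tendsto (fun n : ℕ => (n : ℝ) * (E n - p)) Filter.atTop (nhds e) := by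
  have hq0 : 0 < q := by linarith [hp.2]
  have hq1 : q < 1 := by linarith [hp.1]
  have hk' : (k : ℝ) ≠ 0 := by positivity
  have hqk : 0 < q ^ k := pow_pos hq0 k
  have hqk1 : q ^ k ≤ 1 := pow_le_one₀ hq0.le hq1.le
  have hθI : θ ∈ Set.Icc (0 : ℝ) 1 := ⟨by linarith, by linarith⟩
  have hroot (r : ℝ) : (1 - θ) ^ r = q ^ (k * r) := by
    rw [hθ, sub_sub_cancel, ← Real.rpow_natCast, ← Real.rpow_mul hq0.le]
  have hgθ : g θ = p := by
    simp only [hg]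
    rw [hroot, mul_one_div_cancel hk', Real.rpow_one]
    linarith
  have hgM : ∀ x ∈ Set.Icc (0 : ℝ) 1, |g x| ≤ 1 := by
    intro x hx
    have h0 := sub_nonneg.mpr hx.2
    have h1 := Real.rpow_nonneg h0 ((1 : ℝ) / k)
    have h2 := Real.rpow_le_one h0 (by linarith [hx.1]) (show 0 ≤ (1 : ℝ) / k by positivity)
    simp only [hg]
    exact abs_le.mpr ⟨by linarith, by linarith⟩
  have hpow (r x : ℝ) (hx : x < 1) :
      HasDerivAt (fun y : ℝ => (1 - y) ^ r) (-(r * (1 - x) ^ (r - 1))) x :=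
    (((hasDerivAt_id' x).const_sub 1).rpow_const (Or.inl (sub_pos.mpr hx).ne')).congr_deriv
      (by ring)
  have hg1 : ∀ x ∈ Set.Iio (1 : ℝ),
      HasDerivAt g ((1 : ℝ) / k * (1 - x) ^ ((1 : ℝ) / k - 1)) x := by
    intro x hx
    rw [hg]
    exact ((hpow _ x hx).const_sub 1).congr_deriv (neg_neg _)
  set b : ℝ := ((k : ℝ) - 1) / (2 * k ^ 2) * (1 - θ) ^ ((1 : ℝ) / k - 1 - 1) with hb
  have hg2 : HasDerivAt (fun x : ℝ => (1 : ℝ) / k * (1 - x) ^ ((1 : ℝ) / k - 1)) (2 * b) θ := by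
    refine ((hpow _ θ (by linarith)).const_mul _).congr_deriv ?_
    rw [hb]
    field_simp
    ring
  have hlim := tendsto_mul_binomialMean_sub hθI hgM
    (isLittleO_second_order (convex_Iio 1) (Iio_mem_nhds (by linarith)) hg1 hg2)
  have hbe : b * (θ * (1 - θ)) = e := by
    have hexp : (k : ℝ) * ((1 : ℝ) / k - 1 - 1) = 1 - k - k := by field_simp
    rw [hb, hroot, hexp, he, Real.rpow_sub hq0, Real.rpow_sub hq0, Real.rpow_neg hq0.le,
      Real.rpow_one, Real.rpow_natCast, hθ]
    field_simp
    ring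
  rw [hbe, hgθ] at hlim
  simpa only [hE, binomialMean] using hlim
end
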